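/- Let G = ⟨{H} ∪ L | R⟩ be a premotive game with parity over a poset A, where the left option H is dominated, i.e., H ≤ G^L for some left option G^L ∈ L with G^L ≠ H. Let G' = ⟨L|R⟩ be G with the left option H removed (L nonempty). Then G' is premotive and has parity, and G ≃ G' (G ≤ G' and G' ≤ G in the intrinsic order). Moreover, if G is *-antimonotone, then G' is *-antimonotone. -/

import Mathlib

/-- Games over a poset `α`: atomic games `[a]` for `a : α`, and composite games
`⟨L|R⟩` given by nonempty families of left and right options. -/
inductive Game (α : Type) : Type 1 where
  | atom : α → Game α
  | comp : (ι κ : Type) → (ι → Game α) → (κ → Game α) → Nonempty ι → Nonempty κ → Game α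

namespace Game

variable {α β : Type}

/-- `G'` is a left option of the game. -/
def IsLeftOption (G' : Game α) : Game α → Prop
  | atom _ => False
  | comp _ _ L _ _ _ => ∃ i, L i = G'

/-- `G'` is a right option of the game. -/
def IsRightOption (G' : Game α) : Game α → Prop
  | atom _ => False
  | comp _ _ _ R _ _ => ∃ k, R k = G'

/-- `G'` is an option of `G`. -/
def IsOption (G' G : Game α) : Prop := IsLeftOption G' G ∨ IsRightOption G' G

/-- A game is composite if it is not atomic. -/
def IsComposite : Game α → Prop
  | atom _ => False
  | comp _ _ _ _ _ _ => True

/-- `G'` is a follower of `G`: `G` itself, an option of `G`, or recursively a follower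
of an option of `G`. -/
def IsFollower (G' G : Game α) : Prop := Relation.ReflTransGen IsOption G' G

/-- The dual game: Left and Right switch sides; it is a game over the opposite poset. -/
def dual : Game α → Game αᵒᵈ
  | atom a => atom (OrderDual.toDual a)
  | comp ι κ L R hι hκ => comp κ ι (fun k => (R k).dual) (fun i => (L i).dual) hκ hι

/-- The image of a game under a (monotone) function applied to atoms. -/
def map (f : α → β) : Game α → Game β
  | atom a => atom (f a)
  | comp ι κ L R hι hκ => comp ι κ (fun i => (L i).map f) (fun k => (R k).map f) hι hκ

/-- The (disjunctive) sum of a game over `α` and a game over `β`, a game over `α × β`. -/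
noncomputable def add : Game α → Game β → Game (α × β) := by
  intro G
  induction G with
  | atom g =>
    intro H
    induction H with
    | atom h => exact atom (g, h)
    | comp ι κ L R hι hκ IHL IHR => exact comp ι κ IHL IHR hι hκ
  | comp ι κ L R hι hκ IHL IHR =>
    intro H
    induction H with
    | atom h => exact comp ι κ (fun i => IHL i (atom h)) (fun k => IHR k (atom h)) hι hκ
    | comp ι' κ' L' R' hι' hκ' IHL' IHR' =>
      exact comp (ι ⊕ ι') (κ ⊕ κ')
        (Sum.elim (fun i => IHL i (comp ι' κ' L' R' hι' hκ')) IHL')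
        (Sum.elim (fun k => IHR k (comp ι' κ' L' R' hι' hκ')) IHR')
        (hι.elim fun i => ⟨Sum.inl i⟩) (hκ.elim fun k => ⟨Sum.inl k⟩)

mutual
/-- Left has a first player winning strategy in a game over the boolean poset:
either the game is the atom `⊤`, or some left option has a second player
winning strategy for Left. -/
inductive LeftWinsFirst : Game Bool → Prop where
  | atom_top : LeftWinsFirst (atom true)
  | move {G G' : Game Bool} : IsLeftOption G' G → LeftWinsSecond G' → LeftWinsFirst G

/-- Left has a second player winning strategy in a game over the boolean poset:
every right option has a first player winning strategy for Left, and if the game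
is atomic it is the atom `⊤`. -/
inductive LeftWinsSecond : Game Bool → Prop where
  | mk {G : Game Bool} : (∀ G', IsRightOption G' G → LeftWinsFirst G') →
      (∀ b, G = atom b → b = true) → LeftWinsSecond G
end

mutual
/-- A game is even if all of its options are odd (atomic games are even). -/
inductive Even {α : Type} : Game α → Prop where
  | mk {G : Game α} : (∀ G', IsOption G' G → Odd G') → Even G

/-- A game is odd if it is composite and all of its options are even. -/
inductive Odd {α : Type} : Game α → Prop where
  | mk {G : Game α} : G.IsComposite → (∀ G', IsOption G' G → Even G') → Odd G
end

/-- A game has parity if it is even or odd. -/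
def HasParity (G : Game α) : Prop := Even G ∨ Odd G

/-- `G` and `H` have matching parity (both even or both odd). -/
def MatchingParity (G H : Game α) : Prop := (Even G ∧ Even H) ∨ (Odd G ∧ Odd H)

/-- `G` and `H` have mismatching parity (one even, the other odd). -/
def MismatchParity (G H : Game α) : Prop := (Even G ∧ Odd H) ∨ (Odd G ∧ Even H)

mutual
/-- The intrinsic order `G ≤ H` on games over a poset: every left option `G^L` of `G`
satisfies `G^L ◁ H`, every right option `H^R` of `H` satisfies `G ◁ H^R`, and if
both games are atoms `[g]`, `[h]` then `g ≤ h`. -/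
inductive Le {α : Type} [PartialOrder α] : Game α → Game α → Prop where
  | mk {G H : Game α} :
      (∀ G', IsLeftOption G' G → Tri G' H) →
      (∀ H', IsRightOption H' H → Tri G H') →
      (∀ g h, G = atom g → H = atom h → g ≤ h) →
      Le G H

/-- The intrinsic relation `G ◁ H` on games over a poset: some right option `G^R` of `G`
satisfies `G^R ≤ H`, or some left option `H^L` of `H` satisfies `G ≤ H^L`. -/
inductive Tri {α : Type} [PartialOrder α] : Game α → Game α → Prop where
  | inr {G H G' : Game α} : IsRightOption G' G → Le G' H → Tri G H
  | inl {G H H' : Game α} : IsLeftOption H' H → Le G H' → Tri G H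
end

/-- The comparison game `λ(Gᵒᵖ + H)`, a game over the boolean poset, where
`λ : αᵒᵈ × α → 𝔹` is the monotone map with `λ(xᵒᵖ, y) = ⊤` iff `x ≤ y`. -/
noncomputable def comparison [PartialOrder α] (G H : Game α) : Game Bool :=
  map (fun p : αᵒᵈ × α => @decide (OrderDual.ofDual p.1 ≤ p.2) (Classical.propDecidable _))
    (G.dual.add H)

/-- A game is locally premotive if Left has a first player winning strategy in
the comparison game `λ(Gᵒᵖ + G)`. -/
def LocallyPremotive [PartialOrder α] (G : Game α) : Prop := LeftWinsFirst (comparison G G)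

/-- A game is premotive if it and all of its followers are locally premotive. -/
def Premotive [PartialOrder α] (G : Game α) : Prop :=
  ∀ G', IsFollower G' G → LocallyPremotive G'

/-- The game `* = ⟨0|0⟩` over the one-element poset. -/
def star : Game Unit := comp Unit Unit (fun _ => atom ()) (fun _ => atom ()) ⟨()⟩ ⟨()⟩

/-- `G + *`, identified with a game over `α` via the isomorphism `α × 1 ≅ α`. -/
noncomputable def addStar (G : Game α) : Game α := map Prod.fst (G.add star)

/-- A game is locally `*`-antimonotone if `G^L + * ≤ G ≤ G^R + *` for all left and
right options `G^L`, `G^R`. -/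
def LocallyStarAnti [PartialOrder α] (G : Game α) : Prop :=
  (∀ G', IsLeftOption G' G → Le G'.addStar G) ∧ (∀ G', IsRightOption G' G → Le G G'.addStar)

/-- A game is `*`-antimonotone if it and all of its followers are locally
`*`-antimonotone. -/
def StarAnti [PartialOrder α] (G : Game α) : Prop :=
  ∀ G', IsFollower G' G → LocallyStarAnti G'

/-- `ε(G + X)`: the game `G` over `α` embedded in a context `X`, a game over the poset
`[α, 𝔹]` of monotone functions `α → 𝔹`, via the application map `ε(a, f) = f a`. -/
noncomputable def ctxSum [PartialOrder α] (G : Game α) (X : Game (α →o Bool)) : Game Bool :=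
  map (fun p : α × (α →o Bool) => p.2 p.1) (G.add X)

/-- The outcome `(o_L(G), o_R(G)) ∈ 𝔹 × 𝔹` of a game over the boolean poset:
`o_L(G) = ⊤` iff Left has a first player winning strategy and `o_R(G) = ⊤` iff
Left has a second player winning strategy. -/
noncomputable def outcome (G : Game Bool) : Bool × Bool :=
  (@decide (LeftWinsFirst G) (Classical.propDecidable _),
   @decide (LeftWinsSecond G) (Classical.propDecidable _))

/-- The contextual order `G ≤_c H`: `o(G+X) ≤ o(H+X)` for every context `X`. -/
def ContextualLe [PartialOrder α] (G H : Game α) : Prop :=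
  ∀ X : Game (α →o Bool), outcome (ctxSum G X) ≤ outcome (ctxSum H X)

/-- The contextual relation `G ◁_c H`: `o_R(G+X) ≤ o_L(H+X)` for every context `X`. -/
def ContextualTri [PartialOrder α] (G H : Game α) : Prop :=
  ∀ X : Game (α →o Bool), (outcome (ctxSum G X)).2 ≤ (outcome (ctxSum H X)).1

/-- Two games are identical when they are equal as set-based games: both are the same
atom, or both are composite with identical sets of left options and identical sets of
right options (recursively). -/
def Identical : Game α → Game α → Prop
  | atom a, atom b => a = b
  | comp _ _ L R _ _, comp _ _ L' R' _ _ =>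
      ((∀ i, ∃ i', Identical (L i) (L' i')) ∧ (∀ i', ∃ i, Identical (L i) (L' i'))) ∧
      ((∀ k, ∃ k', Identical (R k) (R' k')) ∧ (∀ k', ∃ k, Identical (R k) (R' k')))
  | _, _ => False

theorem comp_ne_atom {ι κ : Type} {L : ι → Game α} {R : κ → Game α} {hι : Nonempty ι}
    {hκ : Nonempty κ} {a : α} (h : comp ι κ L R hι hκ = atom a) : False := by
  cases h

theorem optInd {P : Game α → Prop} (h : ∀ G, (∀ G', IsOption G' G → P G') → P G) :
    ∀ G, P G := by
  intro G
  induction G with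
  | atom a => exact h _ (fun G' hG' => by rcases hG' with h | h <;> exact h.elim)
  | comp ι κ L R hι hκ IHL IHR =>
    refine h _ (fun G' hG' => ?_)
    rcases hG' with ⟨i, rfl⟩ | ⟨i, rfl⟩
    · exact IHL i
    · exact IHR i

theorem le_iff [PartialOrder α] {G H : Game α} : Le G H ↔
    (∀ G', IsLeftOption G' G → Tri G' H) ∧ (∀ H', IsRightOption H' H → Tri G H') ∧
      (∀ g h, G = atom g → H = atom h → g ≤ h) := by
  constructor
  · intro h
    cases h with
    | mk a b c => exact ⟨a, b, c⟩
  · rintro ⟨a, b, c⟩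
    exact Le.mk a b c

theorem tri_iff [PartialOrder α] {G H : Game α} : Tri G H ↔
    (∃ G', IsRightOption G' G ∧ Le G' H) ∨ (∃ H', IsLeftOption H' H ∧ Le G H') := by
  constructor
  · intro h
    cases h with
    | inr a b => exact Or.inl ⟨_, a, b⟩
    | inl a b => exact Or.inr ⟨_, a, b⟩
  · rintro (⟨_, a, b⟩ | ⟨_, a, b⟩)
    · exact Tri.inr a b
    · exact Tri.inl a b

theorem le_refl' [PartialOrder α] (G : Game α) : Le G G := by
  induction G using optInd with
  | h G IH =>
    refine Le.mk (fun G' h => Tri.inl h (IH _ (Or.inl h)))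
      (fun G' h => Tri.inr h (IH _ (Or.inr h))) ?_
    rintro g h rfl hh
    cases hh
    exact le_refl _

theorem first_iff {G : Game Bool} : LeftWinsFirst G ↔
    G = atom true ∨ ∃ G', IsLeftOption G' G ∧ LeftWinsSecond G' := by
  constructor
  · intro h
    cases h with
    | atom_top => exact Or.inl rfl
    | move a b => exact Or.inr ⟨_, a, b⟩
  · rintro (rfl | ⟨_, a, b⟩)
    · exact .atom_top
    · exact .move a b

theorem second_iff {G : Game Bool} : LeftWinsSecond G ↔
    (∀ G', IsRightOption G' G → LeftWinsFirst G') ∧ (∀ b, G = atom b → b = true) := by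
  constructor
  · intro h
    cases h with
    | mk a b => exact ⟨a, b⟩
  · rintro ⟨a, b⟩
    exact .mk a b

/-- Left wins first in the comparison game. -/
def F [PartialOrder α] (G H : Game α) : Prop := LeftWinsFirst (comparison G H)

/-- Left wins second in the comparison game. -/
def S [PartialOrder α] (G H : Game α) : Prop := LeftWinsSecond (comparison G H)

theorem F_iff [PartialOrder α] {G H : Game α} : F G H ↔
    (∃ g h, G = atom g ∧ H = atom h ∧ g ≤ h) ∨
    (∃ G', IsRightOption G' G ∧ S G' H) ∨ (∃ H', IsLeftOption H' H ∧ S G H') := by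
  unfold F
  rw [first_iff]
  cases G with
  | atom g =>
    cases H with
    | atom h =>
      simp [comparison, dual, add, map, IsLeftOption, IsRightOption]
      exact @decide_eq_true_iff _ (Classical.propDecidable _)
    | comp ι κ L R hι hκ =>
      constructor
      · rintro (h | ⟨_, ⟨i, rfl⟩, h⟩)
        · cases h
        · exact Or.inr (Or.inr ⟨_, ⟨i, rfl⟩, h⟩)
      · rintro (⟨_, _, _, h, _⟩ | ⟨_, h, _⟩ | ⟨_, ⟨i, rfl⟩, h⟩)
        · cases h
        · exact h.elim
        · exact Or.inr ⟨_, ⟨i, rfl⟩, h⟩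
  | comp ι' κ' L' R' hι' hκ' =>
    cases H with
    | atom h =>
      constructor
      · rintro (h | ⟨_, ⟨i, rfl⟩, h⟩)
        · cases h
        · exact Or.inr (Or.inl ⟨_, ⟨i, rfl⟩, h⟩)
      · rintro (⟨_, _, h, _, _⟩ | ⟨_, ⟨i, rfl⟩, h⟩ | ⟨_, h, _⟩)
        · cases h
        · exact Or.inr ⟨_, ⟨i, rfl⟩, h⟩
        · exact h.elim
    | comp ι κ L R hι hκ =>
      constructor
      · rintro (h | ⟨_, ⟨i | i, rfl⟩, h⟩)
        · cases h
        · exact Or.inr (Or.inl ⟨_, ⟨i, rfl⟩, h⟩)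
        · exact Or.inr (Or.inr ⟨_, ⟨i, rfl⟩, h⟩)
      · rintro (⟨_, _, h, _, _⟩ | ⟨_, ⟨i, rfl⟩, h⟩ | ⟨_, ⟨i, rfl⟩, h⟩)
        · cases h
        · exact Or.inr ⟨_, ⟨Sum.inl i, rfl⟩, h⟩
        · exact Or.inr ⟨_, ⟨Sum.inr i, rfl⟩, h⟩

theorem S_iff [PartialOrder α] {G H : Game α} : S G H ↔
    (∀ G', IsLeftOption G' G → F G' H) ∧ (∀ H', IsRightOption H' H → F G H') ∧
      (∀ g h, G = atom g → H = atom h → g ≤ h) := by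
  unfold S
  rw [second_iff]
  cases G with
  | atom g =>
    cases H with
    | atom h =>
      simp [comparison, dual, add, map, IsLeftOption, IsRightOption]
      exact @decide_eq_true_iff _ (Classical.propDecidable _)
    | comp ι κ L R hι hκ =>
      constructor
      · rintro ⟨a, -⟩
        refine ⟨fun _ h => h.elim, ?_, fun _ _ _ h => by cases h⟩
        rintro _ ⟨i, rfl⟩
        exact a _ ⟨i, rfl⟩
      · rintro ⟨-, a, -⟩
        refine ⟨?_, fun _ h => by cases h⟩
        rintro _ ⟨i, rfl⟩
        exact a _ ⟨i, rfl⟩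
  | comp ι' κ' L' R' hι' hκ' =>
    cases H with
    | atom h =>
      constructor
      · rintro ⟨a, -⟩
        refine ⟨?_, fun _ h => h.elim, fun _ _ h _ => by cases h⟩
        rintro _ ⟨i, rfl⟩
        exact a _ ⟨i, rfl⟩
      · rintro ⟨a, -, -⟩
        refine ⟨?_, fun _ h => by cases h⟩
        rintro _ ⟨i, rfl⟩
        exact a _ ⟨i, rfl⟩
    | comp ι κ L R hι hκ =>
      constructor
      · rintro ⟨a, -⟩
        refine ⟨?_, ?_, fun _ _ h _ => by cases h⟩
        · rintro _ ⟨i, rfl⟩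
          exact a _ ⟨Sum.inl i, rfl⟩
        · rintro _ ⟨i, rfl⟩
          exact a _ ⟨Sum.inr i, rfl⟩
      · rintro ⟨a, b, -⟩
        refine ⟨?_, fun _ h => by cases h⟩
        rintro _ ⟨i | i, rfl⟩
        · exact a _ ⟨i, rfl⟩
        · exact b _ ⟨i, rfl⟩

theorem Even.opt {G G' : Game α} (h : Even G) (o : IsOption G' G) : Odd G' := by
  cases h with
  | mk a => exact a _ o

theorem Odd.opt {G G' : Game α} (h : Odd G) (o : IsOption G' G) : Even G' := by
  cases h with
  | mk _ a => exact a _ o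

theorem not_odd_atom {a : α} (h : Odd (atom a)) : False := by
  cases h with
  | mk h _ => exact h

theorem HasParity.opt {G G' : Game α} (h : HasParity G) (o : IsOption G' G) : HasParity G' :=
  h.elim (fun h => Or.inr (h.opt o)) (fun h => Or.inl (h.opt o))

theorem Premotive.opt [PartialOrder α] {G G' : Game α} (h : Premotive G) (o : IsOption G' G) :
    Premotive G' := fun _ hK => h _ (hK.tail o)

theorem Premotive.self [PartialOrder α] {G : Game α} (h : Premotive G) : F G G :=
  h _ Relation.ReflTransGen.refl

theorem premotive_atom [PartialOrder α] (a : α) : Premotive (atom a) := by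
  intro G' h
  rcases Relation.ReflTransGen.cases_tail h with h | ⟨_, _, h | h⟩
  · subst h
    exact F_iff.2 (Or.inl ⟨a, a, rfl, rfl, le_refl a⟩)
  · exact h.elim
  · exact h.elim

theorem MismatchParity.left {G H G' : Game α} (h : MismatchParity G H) (o : IsOption G' G) :
    MatchingParity G' H :=
  h.elim (fun h => Or.inr ⟨h.1.opt o, h.2⟩) (fun h => Or.inl ⟨h.1.opt o, h.2⟩)

theorem MismatchParity.right {G H H' : Game α} (h : MismatchParity G H) (o : IsOption H' H) :
    MatchingParity G H' :=
  h.elim (fun h => Or.inl ⟨h.1, h.2.opt o⟩) (fun h => Or.inr ⟨h.1, h.2.opt o⟩)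

theorem MatchingParity.left {G H G' : Game α} (h : MatchingParity G H) (o : IsOption G' G) :
    MismatchParity G' H :=
  h.elim (fun h => Or.inr ⟨h.1.opt o, h.2⟩) (fun h => Or.inl ⟨h.1.opt o, h.2⟩)

theorem MatchingParity.right {G H H' : Game α} (h : MatchingParity G H) (o : IsOption H' H) :
    MismatchParity G H' :=
  h.elim (fun h => Or.inl ⟨h.1, h.2.opt o⟩) (fun h => Or.inr ⟨h.1, h.2.opt o⟩)

/-- Composition of `≤` with comparison strategies, starting at an atom. -/
theorem atom_trans [PartialOrder α] (x y : α) (hxy : x ≤ y) (Z W : Game α) :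
    (Le (atom y) Z → S Z W → Odd W → S (atom x) W) ∧
    (Le (atom y) Z → F Z W → Even W → F (atom x) W) ∧
    (Tri (atom y) Z → S Z W → Even W → F (atom x) W) := by
  induction Z using optInd generalizing W with
  | h Z IHZ =>
  induction W using optInd with
  | h W IHW =>
  refine ⟨fun a b p => ?_, fun a b p => ?_, fun a b p => ?_⟩
  · rw [S_iff] at b ⊢
    refine ⟨fun _ h => h.elim, fun W' h => (IHW W' (Or.inr h)).2.1 a (b.2.1 W' h)
      (p.opt (Or.inr h)), ?_⟩
    rintro g h _ rfl
    exact (not_odd_atom p).elim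
  · rw [F_iff] at b
    rcases b with ⟨z, w, rfl, rfl, hzw⟩ | ⟨Z', o, b⟩ | ⟨W', o, b⟩
    · exact F_iff.2 (Or.inl ⟨x, w, rfl, rfl,
        hxy.trans (((le_iff.1 a).2.2 y z rfl rfl).trans hzw)⟩)
    · exact (IHZ Z' (Or.inr o) W).2.2 ((le_iff.1 a).2.1 _ o) b p
    · exact F_iff.2 (Or.inr (Or.inr ⟨W', o, (IHW W' (Or.inl o)).1 a b (p.opt (Or.inl o))⟩))
  · rw [tri_iff] at a
    rcases a with ⟨_, o, _⟩ | ⟨Z', o, a⟩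
    · exact o.elim
    · exact (IHZ Z' (Or.inl o) W).2.1 a ((S_iff.1 b).1 _ o) p

/-- Composition of comparison strategies with `≤`. -/
theorem comp_trans [PartialOrder α] (X Y Z : Game α) :
    (S X Y → Le Y Z → Premotive Z → MismatchParity X Z → S X Z) ∧
    (F X Y → Le Y Z → Premotive Z → MatchingParity X Z → F X Z) ∧
    (S X Y → Tri Y Z → Premotive Z → MatchingParity X Z → F X Z) := by
  induction X using optInd generalizing Y Z with
  | h X IHX =>
  induction Y using optInd generalizing Z with
  | h Y IHY =>
  induction Z using optInd with
  | h Z IHZ =>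
  refine ⟨fun a b q p => ?_, fun a b q p => ?_, fun a b q p => ?_⟩
  · rw [S_iff]
    refine ⟨fun X' o => (IHX X' (Or.inl o) Y Z).2.1 ((S_iff.1 a).1 _ o) b q (p.left (Or.inl o)),
      fun Z' o => (IHZ Z' (Or.inr o)).2.2 a ((le_iff.1 b).2.1 _ o) (q.opt (Or.inr o))
        (p.right (Or.inr o)), ?_⟩
    rintro x z rfl rfl
    rcases p with p | p
    · exact (not_odd_atom p.2).elim
    · exact (not_odd_atom p.1).elim
  · rw [F_iff] at a
    rcases a with ⟨x, y, rfl, rfl, hxy⟩ | ⟨X', o, a⟩ | ⟨Y', o, a⟩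
    · rcases p with p | p
      · exact (atom_trans x y hxy Z Z).2.1 b q.self p.2
      · exact (not_odd_atom p.1).elim
    · exact F_iff.2 (Or.inr (Or.inl ⟨X', o,
        (IHX X' (Or.inr o) Y Z).1 a b q (p.left (Or.inr o))⟩))
    · exact (IHY Y' (Or.inl o) Z).2.2 a ((le_iff.1 b).1 _ o) q p
  · rw [tri_iff] at b
    rcases b with ⟨Y', o, b⟩ | ⟨Z', o, b⟩
    · exact (IHY Y' (Or.inr o) Z).2.1 ((S_iff.1 a).2.1 _ o) b q p
    · exact F_iff.2 (Or.inr (Or.inr ⟨Z', o,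
        (IHZ Z' (Or.inl o)).1 a b (q.opt (Or.inl o)) (p.right (Or.inl o))⟩))

theorem atom_not_le [PartialOrder α] (x : α) (Y : Game α) :
    (Le (atom x) Y → Odd Y → False) ∧ (Tri (atom x) Y → Even Y → False) := by
  induction Y using optInd with
  | h Y IH =>
  constructor
  · intro a p
    cases Y with
    | atom y => exact not_odd_atom p
    | comp ι κ L R hι hκ =>
      obtain ⟨k⟩ := hκ
      have o : IsRightOption (R k) (comp ι κ L R hι ⟨k⟩) := ⟨k, rfl⟩
      exact (IH _ (Or.inr o)).2 ((le_iff.1 a).2.1 _ o) (p.opt (Or.inr o))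
  · intro a p
    rw [tri_iff] at a
    rcases a with ⟨_, o, _⟩ | ⟨Y', o, a⟩
    · exact o.elim
    · exact (IH _ (Or.inl o)).1 a (p.opt (Or.inl o))

theorem even_atom (a : α) : Even (atom a) :=
  .mk (fun _ h => by rcases h with h | h <;> exact h.elim)

theorem le_trans' [PartialOrder α] (X Y Z : Game α) (q : Premotive Y) (p : HasParity Y) :
    (Le X Y → Le Y Z → Le X Z) ∧ (Tri X Y → Le Y Z → Tri X Z) ∧
    (Le X Y → Tri Y Z → Tri X Z) := by
  induction X using optInd generalizing Y Z with
  | h X IHX =>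
  induction Y using optInd generalizing Z with
  | h Y IHY =>
  induction Z using optInd with
  | h Z IHZ =>
  refine ⟨fun a b => ?_, fun a b => ?_, fun a b => ?_⟩
  · refine .mk (fun X' o => (IHX X' (Or.inl o) Y Z q p).2.1 ((le_iff.1 a).1 _ o) b)
      (fun Z' o => (IHZ Z' (Or.inr o)).2.2 a ((le_iff.1 b).2.1 _ o)) ?_
    rintro x z rfl rfl
    rcases p with p | p
    · have h1 : F (atom x) Y := (atom_trans x x le_rfl Y Y).2.1 a q.self p
      have h2 : F (atom x) (atom z) := (comp_trans (atom x) Y (atom z)).2.1 h1 b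
        (premotive_atom z) (Or.inl ⟨even_atom x, even_atom z⟩)
      rw [F_iff] at h2
      rcases h2 with ⟨g, h, e1, e2, hl⟩ | ⟨_, o, _⟩ | ⟨_, o, _⟩
      · cases e1
        cases e2
        exact hl
      · exact o.elim
      · exact o.elim
    · exact ((atom_not_le x Y).1 a p).elim
  · rw [tri_iff] at a
    rcases a with ⟨X', o, a⟩ | ⟨Y', o, a⟩
    · exact .inr o ((IHX X' (Or.inr o) Y Z q p).1 a b)
    · exact (IHY Y' (Or.inl o) Z (q.opt (Or.inl o)) (p.opt (Or.inl o))).2.2 a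
        ((le_iff.1 b).1 _ o)
  · rw [tri_iff] at b
    rcases b with ⟨Y', o, b⟩ | ⟨Z', o, b⟩
    · exact (IHY Y' (Or.inr o) Z (q.opt (Or.inr o)) (p.opt (Or.inr o))).2.1
        ((le_iff.1 a).2.1 _ o) b
    · exact .inl o ((IHZ Z' (Or.inl o)).1 a b)

/-- Removing a dominated left option. Let `G = ⟨{H} ∪ L | R⟩` be a
premotive game with parity whose left option `H = Lf i₀` is dominated by a left
option `Lf i₁ ≠ H` with `H ≤ Lf i₁`, and let `G'` be `G` with the left option `H`
removed. Then `G'` is premotive and has parity, `G ≃ G'`, and if `G` is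
`*`-antimonotone then so is `G'`. -/
theorem remove_dominated {α : Type} [PartialOrder α] {ι κ : Type}
    (Lf : ι → Game α) (Rf : κ → Game α) (hι : Nonempty ι) (hκ : Nonempty κ)
    (i₀ i₁ : ι) (hne : Lf i₁ ≠ Lf i₀) (hdom : Le (Lf i₀) (Lf i₁))
    (hprem : Premotive (comp ι κ Lf Rf hι hκ))
    (hpar : HasParity (comp ι κ Lf Rf hι hκ)) :
    let G : Game α := comp ι κ Lf Rf hι hκ
    let G' : Game α := comp {i : ι // Lf i ≠ Lf i₀} κ (fun i => Lf i.1) Rf ⟨⟨i₁, hne⟩⟩ hκ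
    Premotive G' ∧ HasParity G' ∧ Le G G' ∧ Le G' G ∧ (StarAnti G → StarAnti G') := by
  intro G G'
  have oL : ∀ i, IsLeftOption (Lf i) G := fun i => ⟨i, rfl⟩
  have oR : ∀ k, IsRightOption (Rf k) G := fun k => ⟨k, rfl⟩
  have oR' : ∀ k, IsRightOption (Rf k) G' := fun k => ⟨k, rfl⟩
  have oL' : ∀ i, Lf i ≠ Lf i₀ → IsLeftOption (Lf i) G' := fun i h => ⟨⟨i, h⟩, rfl⟩
  have oLG : ∀ X, IsLeftOption X G' → IsLeftOption X G := by
    rintro _ ⟨i, rfl⟩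
    exact oL i.1
  have oG : ∀ X, IsOption X G' → IsOption X G := by
    rintro X (h | h)
    · exact Or.inl (oLG X h)
    · exact Or.inr h
  have natom : ∀ a, G ≠ atom a := fun a h => comp_ne_atom h
  have natom' : ∀ a, G' ≠ atom a := fun a h => comp_ne_atom h
  have hfol : ∀ X, IsFollower X G' → X = G' ∨ IsFollower X G := by
    intro X h
    rcases Relation.ReflTransGen.cases_tail h with h | ⟨Y, h, o⟩
    · exact Or.inl h.symm
    · exact Or.inr (h.tail (oG _ o))
  have p0 : HasParity (Lf i₀) := hpar.opt (Or.inl (oL i₀))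
  have q0 : Premotive (Lf i₀) := hprem.opt (Or.inl (oL i₀))
  have q1 : Premotive (Lf i₁) := hprem.opt (Or.inl (oL i₁))
  have mGG : MatchingParity G G := hpar.elim (fun h => Or.inl ⟨h, h⟩) (fun h => Or.inr ⟨h, h⟩)
  -- a strategy into a left option gives one into a remaining left option
  have key : ∀ X i, S X (Lf i) → MatchingParity X G → ∃ Z, IsLeftOption Z G' ∧ IsLeftOption Z G
      ∧ S X Z := by
    intro X i h m
    by_cases hi : Lf i = Lf i₀
    · rw [hi] at h
      exact ⟨Lf i₁, oL' _ hne, oL _,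
        (comp_trans _ _ _).1 h hdom q1 (m.right (Or.inl (oL i₁)))⟩
    · exact ⟨Lf i, oL' _ hi, oL _, h⟩
  have keyLe : ∀ X i, Le X (Lf i) → ∃ Z, IsLeftOption Z G' ∧ Le X Z := by
    intro X i h
    by_cases hi : Lf i = Lf i₀
    · rw [hi] at h
      exact ⟨Lf i₁, oL' _ hne, (le_trans' _ _ _ q0 p0).1 h hdom⟩
    · exact ⟨Lf i, oL' _ hi, h⟩
  have hA : ∀ X, (S X G → MismatchParity X G → S X G') ∧
      (F X G → MatchingParity X G → F X G') := by
    intro X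
    induction X using optInd with
    | h X IH =>
    constructor
    · intro a m
      rw [S_iff] at a ⊢
      exact ⟨fun X' o => (IH _ (Or.inl o)).2 (a.1 _ o) (m.left (Or.inl o)),
        fun Y o => a.2.1 _ o, fun _ h _ e => (natom' h e).elim⟩
    · intro a m
      rw [F_iff] at a
      rcases a with ⟨_, h, _, e, _⟩ | ⟨X', o, a⟩ | ⟨_, ⟨i, rfl⟩, a⟩
      · exact (natom h e).elim
      · exact F_iff.2 (Or.inr (Or.inl ⟨X', o, (IH _ (Or.inr o)).1 a (m.left (Or.inr o))⟩))
      · obtain ⟨Z, o, -, h⟩ := key X i a m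
        exact F_iff.2 (Or.inr (Or.inr ⟨Z, o, h⟩))
  have hB : ∀ X, (S G X → S G' X) ∧ (F G X → F G' X) := by
    intro X
    induction X using optInd with
    | h X IH =>
    constructor
    · intro a
      rw [S_iff] at a ⊢
      exact ⟨fun Y o => a.1 _ (oLG _ o), fun X' o => (IH _ (Or.inr o)).2 (a.2.1 _ o),
        fun g _ e _ => (natom' g e).elim⟩
    · intro a
      rw [F_iff] at a
      rcases a with ⟨g, _, e, _⟩ | ⟨Y, o, a⟩ | ⟨X', o, a⟩
      · exact (natom g e).elim
      · exact F_iff.2 (Or.inr (Or.inl ⟨Y, o, a⟩))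
      · exact F_iff.2 (Or.inr (Or.inr ⟨X', o, (IH _ (Or.inl o)).1 a⟩))
  have hC : ∀ X, (Le X G → Le X G') ∧ (Tri X G → Tri X G') := by
    intro X
    induction X using optInd with
    | h X IH =>
    constructor
    · intro a
      rw [le_iff] at a ⊢
      exact ⟨fun X' o => (IH _ (Or.inl o)).2 (a.1 _ o),
        fun Y o => a.2.1 _ o, fun _ h _ e => (natom' h e).elim⟩
    · intro a
      rw [tri_iff] at a
      rcases a with ⟨X', o, a⟩ | ⟨_, ⟨i, rfl⟩, a⟩
      · exact .inr o ((IH _ (Or.inr o)).1 a)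
      · obtain ⟨Z, o, h⟩ := keyLe X i a
        exact .inl o h
  have hD : ∀ X, (Le G X → Le G' X) ∧ (Tri G X → Tri G' X) := by
    intro X
    induction X using optInd with
    | h X IH =>
    constructor
    · intro a
      rw [le_iff] at a ⊢
      exact ⟨fun Y o => a.1 _ (oLG _ o), fun X' o => (IH _ (Or.inr o)).2 (a.2.1 _ o),
        fun g _ e _ => (natom' g e).elim⟩
    · intro a
      rw [tri_iff] at a
      rcases a with ⟨Y, o, a⟩ | ⟨X', o, a⟩
      · exact .inr (G := G') (G' := Y) o a
      · exact .inl o ((IH _ (Or.inl o)).1 a)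
  refine ⟨?_, ?_, (hC G).1 (le_refl' G), (hD G).1 (le_refl' G), ?_⟩
  · intro X hX
    rcases hfol X hX with rfl | h
    · have hs : F G G := hprem.self
      rw [F_iff] at hs
      rcases hs with ⟨g, _, e, _⟩ | ⟨_, ⟨k, rfl⟩, a⟩ | ⟨_, ⟨i, rfl⟩, a⟩
      · exact (natom g e).elim
      · exact F_iff.2 (Or.inr (Or.inl ⟨Rf k, oR' k,
          (hA _).1 a (mGG.left (Or.inr (oR k)))⟩))
      · obtain ⟨Z, o, -, h⟩ := key G i a mGG
        exact F_iff.2 (Or.inr (Or.inr ⟨Z, o, (hB _).1 h⟩))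
    · exact hprem _ h
  · rcases hpar with h | h
    · exact Or.inl (.mk fun X o => h.opt (oG X o))
    · exact Or.inr (.mk trivial fun X o => h.opt (oG X o))
  · intro hs X hX
    rcases hfol X hX with rfl | h
    · obtain ⟨h1, h2⟩ := hs G Relation.ReflTransGen.refl
      exact ⟨fun Y o => (hC _).1 (h1 Y (oLG _ o)), fun Y o => (hD _).1 (h2 Y o)⟩
    · exact hs _ h

end Game
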